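/- Let M be a matroid on a finite ground set E, let i ∈ E, and let j ≥ 1 be an integer. Then the map F ↦ F ∪ {i} is a bijection from {F ∈ S : rk_M(F) = j} onto {G ∈ U : rk_M(G) = j + 1}. -/

import Mathlib

open Finset MvPolynomial

variable {α : Type*} [DecidableEq α]

/-- A matroid rank function on the ground set `E`: it satisfies `rk A ≤ |A|`, monotonicity and
submodularity (on subsets of `E`). -/
def IsMatroidRank (E : Finset α) (rk : Finset α → ℕ) : Prop :=
  (∀ A ⊆ E, rk A ≤ A.card) ∧
  (∀ A B : Finset α, A ⊆ B → B ⊆ E → rk A ≤ rk B) ∧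
  (∀ A B : Finset α, A ⊆ E → B ⊆ E → rk (A ∪ B) + rk (A ∩ B) ≤ rk A + rk B)

/-- `F` is a flat of the matroid on `E` with rank function `rk`:
`F ⊆ E` and `rk F < rk (F ∪ {j})` for every `j ∈ E ∖ F`. -/
def IsFlat (E : Finset α) (rk : Finset α → ℕ) (F : Finset α) : Prop :=
  F ⊆ E ∧ ∀ j ∈ E \ F, rk F < rk (insert j F)

instance (E : Finset α) (rk : Finset α → ℕ) (F : Finset α) : Decidable (IsFlat E rk F) :=
  inferInstanceAs (Decidable (F ⊆ E ∧ ∀ j ∈ E \ F, rk F < rk (insert j F)))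

/-- `L(M)`: the finset of nonempty flats of the matroid on `E` with rank function `rk`. -/
def flats (E : Finset α) (rk : Finset α → ℕ) : Finset (Finset α) :=
  E.powerset.filter fun F => F.Nonempty ∧ IsFlat E rk F

/-- `T`: nonempty flats `F` with `i ∉ F` such that `F ∪ {i}` is not a flat. -/
def Tset (E : Finset α) (rk : Finset α → ℕ) (i : α) : Finset (Finset α) :=
  (flats E rk).filter fun F => i ∉ F ∧ ¬ IsFlat E rk (insert i F)

/-- `S`: nonempty flats `F` with `i ∉ F` such that `F ∪ {i}` is a flat. -/
def Sset (E : Finset α) (rk : Finset α → ℕ) (i : α) : Finset (Finset α) :=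
  (flats E rk).filter fun F => i ∉ F ∧ IsFlat E rk (insert i F)

/-- `U`: nonempty flats `F` with `i ∈ F` such that `F ∖ {i}` is a flat or `F ∖ {i} = ∅`. -/
def Uset (E : Finset α) (rk : Finset α → ℕ) (i : α) : Finset (Finset α) :=
  (flats E rk).filter fun F => i ∈ F ∧ (IsFlat E rk (F.erase i) ∨ F.erase i = ∅)

/-- `V`: nonempty flats `F` with `i ∈ F`, `F ∖ {i} ≠ ∅` and `F ∖ {i}` not a flat. -/
def Vset (E : Finset α) (rk : Finset α → ℕ) (i : α) : Finset (Finset α) :=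
  (flats E rk).filter fun F => i ∈ F ∧ F.erase i ≠ ∅ ∧ ¬ IsFlat E rk (F.erase i)

theorem IsMatroidRank.rk_insert_le {E : Finset α} {rk : Finset α → ℕ} (hM : IsMatroidRank E rk)
    {i : α} (hi : i ∈ E) {F : Finset α} (hF : F ⊆ E) : rk (insert i F) ≤ rk F + 1 := by
  obtain ⟨hcard, -, hsub⟩ := hM
  have hiE : {i} ⊆ E := Finset.singleton_subset_iff.2 hi
  have h₁ := hsub {i} F hiE hF
  have h₂ := hcard {i} hiE
  rw [Finset.card_singleton] at h₂
  rw [Finset.insert_eq]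
  omega

theorem IsFlat.rk_insert {E : Finset α} {rk : Finset α → ℕ} {F : Finset α} (hF : IsFlat E rk F)
    (hM : IsMatroidRank E rk) {i : α} (hi : i ∈ E) (hiF : i ∉ F) :
    rk (insert i F) = rk F + 1 :=
  le_antisymm (hM.rk_insert_le hi hF.1) (hF.2 i (Finset.mem_sdiff.2 ⟨hi, hiF⟩))

theorem mem_flats {E : Finset α} {rk : Finset α → ℕ} {F : Finset α} :
    F ∈ flats E rk ↔ F.Nonempty ∧ IsFlat E rk F := by
  rw [flats, Finset.mem_filter, Finset.mem_powerset]
  exact and_iff_right_of_imp fun h => h.2.1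

/-- For `j ≥ 1`, the map `F ↦ F ∪ {i}` is a bijection from the rank-`j` members of `S` onto the
rank-`(j+1)` members of `U`. -/
theorem S_U_rank_bijection (E : Finset α) (rk : Finset α → ℕ) (hM : IsMatroidRank E rk)
    (i : α) (hi : i ∈ E) (j : ℕ) (hj : 1 ≤ j) :
    Set.BijOn (fun F => insert i F)
      (((Sset E rk i).filter fun F => rk F = j : Finset (Finset α)) : Set (Finset α))
      (((Uset E rk i).filter fun G => rk G = j + 1 : Finset (Finset α)) : Set (Finset α)) := by
  simp only [Sset, Uset]
  refine ⟨fun F hF => ?_, fun F hF G hG h => ?_, fun G hG => ?_⟩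
  · simp only [Finset.mem_coe, Finset.mem_filter, mem_flats] at hF ⊢
    obtain ⟨⟨⟨-, hF⟩, hiF, hins⟩, hr⟩ := hF
    refine ⟨⟨⟨Finset.insert_nonempty i F, hins⟩, Finset.mem_insert_self i F, ?_⟩, ?_⟩
    · rw [Finset.erase_insert hiF]
      exact Or.inl hF
    · rw [hF.rk_insert hM hi hiF, hr]
  · simp only [Finset.mem_coe, Finset.mem_filter] at hF hG
    have := congrArg (fun A => Finset.erase A i) h
    simpa only [Finset.erase_insert hF.1.2.1, Finset.erase_insert hG.1.2.1] using this
  · simp only [Finset.mem_coe, Finset.mem_filter, mem_flats] at hG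
    obtain ⟨⟨⟨-, hG⟩, hiG, hflat⟩, hr⟩ := hG
    have hins : insert i (G.erase i) = G := Finset.insert_erase hiG
    have hne : G.erase i ≠ ∅ := by
      intro h0
      have h₁ := hM.1 G hG.1
      rw [← hins, h0, insert_empty_eq, Finset.card_singleton] at h₁
      rw [← hins, h0, insert_empty_eq] at hr
      omega
    have hfl := hflat.resolve_right hne
    have hiG' := Finset.notMem_erase i G
    have hrk := hfl.rk_insert hM hi hiG'
    rw [hins] at hrk
    refine ⟨G.erase i, ?_, hins⟩
    simp only [Finset.mem_coe, Finset.mem_filter, mem_flats]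
    exact ⟨⟨⟨Finset.nonempty_iff_ne_empty.2 hne, hfl⟩, hiG', hins.symm ▸ hG⟩, by omega⟩
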